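/- Let V ⊆ ℝ² and U ⊆ ℂ be open, let λ : V → ℂ be C¹, and let x₊, ξ₊ : U → ℝ be C¹ functions (of the real variables (Re z, Im z)) such that (x₊(z), ξ₊(z)) ∈ V and λ(x₊(z), ξ₊(z)) = z for all z ∈ U, and such that {λ̄, λ}(x₊(z), ξ₊(z)) ≠ 0 on U. Then for all z ∈ U, with all derivatives of λ evaluated at (x₊(z), ξ₊(z)): ∂_z x₊ = (∂_ξ λ̄)/{λ̄, λ}, ∂_{z̄} x₊ = −(∂_ξ λ)/{λ̄, λ}, ∂_z ξ₊ = −(∂_x λ̄)/{λ̄, λ}, and ∂_{z̄} ξ₊ = (∂_x λ)/{λ̄, λ}. -/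

import Mathlib

/-- The derivative of the conjugate of a function is the conjugate of its derivative. -/
theorem fderiv_starRingEnd_comp_apply {E : Type*} [NormedAddCommGroup E] [NormedSpace ℝ E]
    {f : E → ℂ} {p : E} (hf : DifferentiableAt ℝ f p) (v : E) :
    fderiv ℝ (fun q => starRingEnd ℂ (f q)) p v = starRingEnd ℂ (fderiv ℝ f p v) := by
  have h := (Complex.conjCLE.toContinuousLinearMap.hasFDerivAt (x := f p)).comp p hf.hasFDerivAt
  exact congrArg (fun L => L v) h.fderiv

/-- The derivative of a real function viewed as a complex one is the cast of its derivative. -/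
theorem fderiv_ofReal_comp_apply {E : Type*} [NormedAddCommGroup E] [NormedSpace ℝ E]
    {f : E → ℝ} {p : E} (hf : DifferentiableAt ℝ f p) (v : E) :
    fderiv ℝ (fun q => (f q : ℂ)) p v = (fderiv ℝ f p v : ℂ) := by
  have h := (Complex.ofRealCLM.hasFDerivAt (x := f p)).comp p hf.hasFDerivAt
  exact congrArg (fun L => L v) h.fderiv

/-- The differentiated form of `f (x z, ξ z) = z`. -/
theorem fderiv_right_inverse_apply {f : ℝ × ℝ → ℂ} {x ξ : ℂ → ℝ} {z : ℂ}
    (hf : DifferentiableAt ℝ f (x z, ξ z)) (hx : DifferentiableAt ℝ x z)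
    (hξ : DifferentiableAt ℝ ξ z) (h : ∀ᶠ w in nhds z, f (x w, ξ w) = w) (v : ℂ) :
    (fderiv ℝ x z v : ℂ) * fderiv ℝ f (x z, ξ z) (1, 0) +
      (fderiv ℝ ξ z v : ℂ) * fderiv ℝ f (x z, ξ z) (0, 1) = v := by
  have hcomp : HasFDerivAt (fun w => f (x w, ξ w))
      ((fderiv ℝ f (x z, ξ z)).comp ((fderiv ℝ x z).prod (fderiv ℝ ξ z))) z :=
    HasFDerivAt.comp (f := fun w => (x w, ξ w)) z hf.hasFDerivAt
      (hx.hasFDerivAt.prodMk hξ.hasFDerivAt)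
  have hL := congrArg (fun L => L v)
    (hcomp.unique ((hasFDerivAt_id (𝕜 := ℝ) z).congr_of_eventuallyEq h))
  have hv : ((fderiv ℝ x z v, fderiv ℝ ξ z v) : ℝ × ℝ) =
      fderiv ℝ x z v • ((1, 0) : ℝ × ℝ) + fderiv ℝ ξ z v • ((0, 1) : ℝ × ℝ) := by
    simp
  change fderiv ℝ f (x z, ξ z) (fderiv ℝ x z v, fderiv ℝ ξ z v) = v at hL
  rw [hv, map_add, map_smul, map_smul, Complex.real_smul, Complex.real_smul] at hL
  exact hL


open Complex

/-- The Poisson bracket `{f, g}(ρ) = (∂_ξ f ∂_x g − ∂_x f ∂_ξ g)(ρ)` of two functions on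
`ℝ²_{x,ξ}`. -/
noncomputable def poissonBracket (f g : ℝ × ℝ → ℂ) (ρ : ℝ × ℝ) : ℂ :=
  fderiv ℝ f ρ (0, 1) * fderiv ℝ g ρ (1, 0) - fderiv ℝ f ρ (1, 0) * fderiv ℝ g ρ (0, 1)

/-- The Wirtinger derivative `∂_z u = (∂_{Re z} u − i ∂_{Im z} u)/2`. -/
noncomputable def wirtZ (u : ℂ → ℂ) (z : ℂ) : ℂ :=
  (fderiv ℝ u z 1 - Complex.I * fderiv ℝ u z Complex.I) / 2

/-- The Wirtinger derivative `∂_{z̄} u = (∂_{Re z} u + i ∂_{Im z} u)/2`. -/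
noncomputable def wirtZbar (u : ℂ → ℂ) (z : ℂ) : ℂ :=
  (fderiv ℝ u z 1 + Complex.I * fderiv ℝ u z Complex.I) / 2

/-- if `λ(x₊(z), ξ₊(z)) = z` with `{λ̄, λ} ≠ 0` along the zero set, then
`∂_z x₊ = ∂_ξ λ̄ / {λ̄, λ}`, `∂_{z̄} x₊ = −∂_ξ λ / {λ̄, λ}`, `∂_z ξ₊ = −∂_x λ̄ / {λ̄, λ}` and
`∂_{z̄} ξ₊ = ∂_x λ / {λ̄, λ}` (all derivatives of `λ` evaluated at `(x₊(z), ξ₊(z))`). -/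
theorem wirtinger_derivatives_of_root_functions
    (V : Set (ℝ × ℝ)) (hV : IsOpen V) (U : Set ℂ) (hU : IsOpen U)
    (lam : ℝ × ℝ → ℂ) (hlam : ContDiffOn ℝ 1 lam V)
    (xp ξp : ℂ → ℝ) (hxp : ContDiffOn ℝ 1 xp U) (hξp : ContDiffOn ℝ 1 ξp U)
    (hmem : ∀ z ∈ U, (xp z, ξp z) ∈ V)
    (heq : ∀ z ∈ U, lam (xp z, ξp z) = z)
    (hbr : ∀ z ∈ U,
      poissonBracket (fun ρ => starRingEnd ℂ (lam ρ)) lam (xp z, ξp z) ≠ 0) :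
    ∀ z ∈ U,
      wirtZ (fun w => (xp w : ℂ)) z =
          fderiv ℝ (fun ρ => starRingEnd ℂ (lam ρ)) (xp z, ξp z) (0, 1) /
            poissonBracket (fun ρ => starRingEnd ℂ (lam ρ)) lam (xp z, ξp z) ∧
      wirtZbar (fun w => (xp w : ℂ)) z =
          -(fderiv ℝ lam (xp z, ξp z) (0, 1)) /
            poissonBracket (fun ρ => starRingEnd ℂ (lam ρ)) lam (xp z, ξp z) ∧
      wirtZ (fun w => (ξp w : ℂ)) z =
          -(fderiv ℝ (fun ρ => starRingEnd ℂ (lam ρ)) (xp z, ξp z) (1, 0)) /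
            poissonBracket (fun ρ => starRingEnd ℂ (lam ρ)) lam (xp z, ξp z) ∧
      wirtZbar (fun w => (ξp w : ℂ)) z =
          fderiv ℝ lam (xp z, ξp z) (1, 0) /
            poissonBracket (fun ρ => starRingEnd ℂ (lam ρ)) lam (xp z, ξp z) := by
  intro z hz
  have hl : DifferentiableAt ℝ lam (xp z, ξp z) :=
    (hlam.contDiffAt (hV.mem_nhds (hmem z hz))).differentiableAt one_ne_zero
  have hx : DifferentiableAt ℝ xp z :=
    (hxp.contDiffAt (hU.mem_nhds hz)).differentiableAt one_ne_zero
  have hξ : DifferentiableAt ℝ ξp z :=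
    (hξp.contDiffAt (hU.mem_nhds hz)).differentiableAt one_ne_zero
  have hinv := fderiv_right_inverse_apply hl hx hξ (Filter.eventually_of_mem (hU.mem_nhds hz) heq)
  have h1 := hinv 1
  have hI := hinv I
  have h1c := congrArg (starRingEnd ℂ) h1
  have hIc := congrArg (starRingEnd ℂ) hI
  have hb := hbr z hz
  simp only [map_add, map_mul, map_one, conj_ofReal, conj_I] at h1c hIc
  simp only [poissonBracket, wirtZ, wirtZbar, fderiv_starRingEnd_comp_apply hl,
    fderiv_ofReal_comp_apply hx, fderiv_ofReal_comp_apply hξ] at hb ⊢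
  generalize fderiv ℝ lam (xp z, ξp z) (1, 0) = a at *
  generalize fderiv ℝ lam (xp z, ξp z) (0, 1) = b at *
  generalize starRingEnd ℂ a = a' at *
  generalize starRingEnd ℂ b = b' at *
  refine ⟨?_, ?_, ?_, ?_⟩ <;> rw [eq_div_iff hb]
  · linear_combination (b' * h1 - b * h1c - I * (b' * hI - b * hIc)) / 2 - (b' + b) / 2 * I_sq
  · linear_combination (b' * h1 - b * h1c + I * (b' * hI - b * hIc)) / 2 + (b' + b) / 2 * I_sq
  · linear_combination (a * h1c - a' * h1 - I * (a * hIc - a' * hI)) / 2 + (a' + a) / 2 * I_sq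
  · linear_combination (a * h1c - a' * h1 + I * (a * hIc - a' * hI)) / 2 - (a' + a) / 2 * I_sq
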